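/- Let d, β ∈ ℕ, L₁, …, L_β > 0, and Δt₀ > 0. Let f : ℝ^d → ℝ^d be β-times continuously differentiable with sup_x ‖D^k f(x)‖_op ≤ L_k for all k ∈ {1, …, β}. Then for every k ∈ {1, …, β} there is a constant C_k > 0, depending only on k, Δt₀, and L₁, …, L_k, such that for all Δt ∈ [0, Δt₀]: sup_{x∈ℝ^d} ‖D^k_x Υ(f, Δt, x)‖_op ≤ C_k·(exp(L₁·Δt) − 1), where D^k_x denotes the k-th derivative with respect to x. -/

import Mathlib

open Set Filter Topology
set_option linter.unusedSectionVars false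

section Nem
variable {E F G : Type} [NormedAddCommGroup E] [NormedSpace ℝ E] [NormedAddCommGroup G] [NormedSpace ℝ G]
  [NormedAddCommGroup F] [NormedSpace ℝ F]

/-- Pointwise bilinear product of curves, as an algebraic bilinear map. -/
noncomputable def nemMulAux (B : G →L[ℝ] E →L[ℝ] F) :
    C(unitInterval, G) →ₗ[ℝ] C(unitInterval, E) →ₗ[ℝ] C(unitInterval, F) :=
  LinearMap.mk₂ ℝ (fun (A : C(unitInterval, G)) (u : C(unitInterval, E)) =>
      (⟨fun s => B (A s) (u s), by fun_prop⟩ : C(unitInterval, F)))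
    (by intros; ext; simp) (by intros; ext; simp) (by intros; ext; simp)
    (by intros; ext; simp)

lemma nemMulAux_norm_le (B : G →L[ℝ] E →L[ℝ] F) (A : C(unitInterval, G)) (u : C(unitInterval, E)) :
    ‖nemMulAux B A u‖ ≤ ‖B‖ * ‖A‖ * ‖u‖ := by
  rw [ContinuousMap.norm_le _ (by positivity)]
  intro s
  refine (B.le_opNorm₂ (A s) (u s)).trans ?_
  have h1 := A.norm_coe_le_norm s
  have h2 := u.norm_coe_le_norm s
  gcongr

/-- Pointwise bilinear product of curves. -/
noncomputable def nemMul (B : G →L[ℝ] E →L[ℝ] F) :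
    C(unitInterval, G) →L[ℝ] C(unitInterval, E) →L[ℝ] C(unitInterval, F) :=
  LinearMap.mkContinuous₂ (nemMulAux B) ‖B‖ (nemMulAux_norm_le B)

@[simp] lemma nemMul_apply (B : G →L[ℝ] E →L[ℝ] F) (A : C(unitInterval, G))
    (u : C(unitInterval, E)) (s : unitInterval) :
    nemMul B A u s = B (A s) (u s) := rfl

lemma nemMul_norm_le (B : G →L[ℝ] E →L[ℝ] F) (hB : ‖B‖ ≤ 1) (A : C(unitInterval, G)) :
    ‖nemMul B A‖ ≤ ‖A‖ :=
  ContinuousLinearMap.opNorm_le_bound (nemMul B A) (norm_nonneg A) fun u =>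
    (nemMulAux_norm_le B A u).trans (by
      have := norm_nonneg A
      have : ‖B‖ * ‖A‖ ≤ ‖A‖ := mul_le_of_le_one_left this hB
      gcongr)

/-- The Nemytskii (superposition) operator. -/
noncomputable def nem (f : E → F) (hf : Continuous f) (u : C(unitInterval, E)) : C(unitInterval, F) :=
  (⟨f, hf⟩ : C(E, F)).comp u

@[simp] lemma nem_apply (f : E → F) (hf : Continuous f) (u : C(unitInterval, E)) (s : unitInterval) :
    nem f hf u s = f (u s) := rfl

lemma nem_continuous (f : E → F) (hf : Continuous f) : Continuous (nem f hf) :=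
  ContinuousMap.continuous_postcomp _

lemma nem_hasFDerivAt (f : E → F) (hf : Differentiable ℝ f) (hf' : Continuous (fderiv ℝ f))
    (u : C(unitInterval, E)) :
    HasFDerivAt (nem f hf.continuous) (nemMul (.id ℝ (E →L[ℝ] F)) (nem (fderiv ℝ f) hf' u)) u := by
  rw [hasFDerivAt_iff_isLittleO_nhds_zero, Asymptotics.isLittleO_iff]
  intro c hc
  have h := (nem_continuous (fderiv ℝ f) hf').continuousAt (x := u)
  rw [Metric.continuousAt_iff] at h
  obtain ⟨δ, hδ, h⟩ := h c hc
  filter_upwards [Metric.ball_mem_nhds (0 : C(unitInterval, E)) hδ] with w hw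
  rw [mem_ball_zero_iff] at hw
  rw [ContinuousMap.norm_le _ (by positivity)]
  intro s
  have key : ∀ z ∈ Metric.ball (u s) δ, ‖fderiv ℝ f z - fderiv ℝ f (u s)‖ ≤ c := by
    intro z hz
    have h1 : dist (u + ContinuousMap.const _ (z - u s)) u < δ := by
      rw [dist_eq_norm, add_sub_cancel_left]
      refine lt_of_le_of_lt ?_ (mem_ball_iff_norm.1 hz)
      rw [ContinuousMap.norm_le _ (norm_nonneg _)]
      intro _; simp
    have h2 := h h1
    rw [dist_eq_norm] at h2
    have h3 := (ContinuousMap.norm_coe_le_norm _ s).trans h2.le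
    simpa using h3
  have hws : ‖w s‖ < δ := (w.norm_coe_le_norm s).trans_lt hw
  have := (convex_ball (u s) δ).norm_image_sub_le_of_norm_fderiv_le' (𝕜 := ℝ) (f := f)
    (φ := fderiv ℝ f (u s)) (C := c) (x := u s) (y := u s + w s)
    (fun x _ => hf x) key (Metric.mem_ball_self hδ) (by simpa [mem_ball_iff_norm] using hws)
  simp only [ContinuousMap.sub_apply, nem_apply, ContinuousMap.add_apply, nemMul_apply]
  rw [add_sub_cancel_left] at this
  exact this.trans (mul_le_mul_of_nonneg_left (w.norm_coe_le_norm s) hc.le)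

lemma nem_contDiff (n : ℕ) : ∀ {F : Type} [NormedAddCommGroup F] [NormedSpace ℝ F]
    (f : E → F) (hf : ContDiff ℝ n f), ContDiff ℝ n (nem f hf.continuous) := by
  induction n with
  | zero =>
    intro F _ _ f hf
    exact contDiff_zero.2 (nem_continuous f _)
  | succ n ih =>
    intro F _ _ f hf
    have hf2 : ContDiff ℝ ((n : WithTop ℕ∞) + 1) f := by exact_mod_cast hf
    have h1 := (contDiff_succ_iff_fderiv.1 hf2)
    have h3 : ContDiff ℝ n (fderiv ℝ f) := h1.2.2
    have : ContDiff ℝ ((n : WithTop ℕ∞) + 1) (nem f hf.continuous) := by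
      rw [contDiff_succ_iff_hasFDerivAt]
      have hc : ContDiff ℝ n fun u : C(unitInterval, E) =>
          nemMul (.id ℝ (E →L[ℝ] F)) (nem (fderiv ℝ f) h3.continuous u) :=
        ContDiff.comp (g := fun A => nemMul (.id ℝ (E →L[ℝ] F)) A)
          (ContinuousLinearMap.contDiff _) (ih _ h3)
      exact ⟨_, hc, fun u => nem_hasFDerivAt f h1.1 h3.continuous u⟩
    exact_mod_cast this

/-- The Volterra operator. -/
noncomputable def volt : C(unitInterval, E) →L[ℝ] C(unitInterval, E) :=
  LinearMap.mkContinuous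
    { toFun := fun g => ⟨fun s => ∫ r in (0:ℝ)..s, g (projIcc 0 1 zero_le_one r), by
        have : Continuous fun b : ℝ => ∫ r in (0:ℝ)..b, g (projIcc 0 1 zero_le_one r) :=
          intervalIntegral.continuous_primitive
            (fun a b => (g.continuous.comp continuous_projIcc).intervalIntegrable a b) 0
        exact this.comp continuous_subtype_val⟩
      map_add' := by
        intro g h
        ext s
        simp only [ContinuousMap.add_apply, ContinuousMap.coe_mk]
        exact intervalIntegral.integral_add
          ((g.continuous.comp continuous_projIcc).intervalIntegrable _ _)
          ((h.continuous.comp continuous_projIcc).intervalIntegrable _ _)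
      map_smul' := by
        intro c g
        ext s
        simp } 1 (by
    intro g
    rw [ContinuousMap.norm_le _ (by positivity)]
    intro s
    simp only [LinearMap.coe_mk, AddHom.coe_mk, ContinuousMap.coe_mk]
    refine (intervalIntegral.norm_integral_le_of_norm_le_const (C := ‖g‖)
      (fun r _ => g.norm_coe_le_norm _)).trans ?_
    have h0 := s.2.1
    have h1 := s.2.2
    rw [sub_zero, abs_of_nonneg h0, one_mul]
    exact mul_le_of_le_one_right (norm_nonneg _) h1)

lemma volt_apply (g : C(unitInterval, E)) (s : unitInterval) :
    volt g s = ∫ r in (0:ℝ)..s, g (projIcc 0 1 zero_le_one r) := rfl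

lemma volt_norm_le : ‖(volt : C(unitInterval, E) →L[ℝ] C(unitInterval, E))‖ ≤ 1 :=
  LinearMap.mkContinuous_norm_le _ zero_le_one _

end Nem

section Comp
variable {E : Type} [NormedAddCommGroup E] [NormedSpace ℝ E]

/-- Remainder constant in the chain rule bound. -/
noncomputable def compM (n : ℕ) (C D : ℝ) : ℝ :=
  ∑ i ∈ Finset.range n, (n.choose (i + 1) : ℝ) * ((i + 1).factorial * C * D ^ (i + 1)) * D

lemma compM_nonneg (n : ℕ) {C D : ℝ} (hC : 0 ≤ C) (hD : 0 ≤ D) : 0 ≤ compM n C D := by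
  unfold compM; positivity

lemma norm_fderiv_of_one (f : E → E) (x : E) : ‖fderiv ℝ f x‖ = ‖iteratedFDeriv ℝ 1 f x‖ := by
  have := norm_iteratedFDeriv_fderiv (𝕜 := ℝ) (f := f) (x := x) (n := 0)
  rw [norm_iteratedFDeriv_zero] at this
  exact this

lemma comp_bound (n : ℕ) {f g : E → E} (hf : ContDiff ℝ (n + 1 : ℕ) f)
    (hg : ContDiff ℝ (n + 1 : ℕ) g)
    (x : E) {L C D : ℝ} (hD1 : 1 ≤ D)
    (hL : ‖iteratedFDeriv ℝ 1 f (g x)‖ ≤ L)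
    (hC : ∀ j, 1 ≤ j → j ≤ n + 1 → ‖iteratedFDeriv ℝ j f (g x)‖ ≤ C)
    (hD : ∀ j, 1 ≤ j → j ≤ n → ‖iteratedFDeriv ℝ j g x‖ ≤ D) :
    ‖iteratedFDeriv ℝ (n + 1) (fun y => f (g y)) x‖
      ≤ L * ‖iteratedFDeriv ℝ (n + 1) g x‖ + compM n C D := by
  have hf2 : ContDiff ℝ ((n : WithTop ℕ∞) + 1) f := by exact_mod_cast hf
  have hg2 : ContDiff ℝ ((n : WithTop ℕ∞) + 1) g := by exact_mod_cast hg
  obtain ⟨hfd, -, hf3⟩ := contDiff_succ_iff_fderiv.1 hf2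
  obtain ⟨hgd, -, hg3⟩ := contDiff_succ_iff_fderiv.1 hg2
  have hgn : ContDiff ℝ n g := hg2.of_le (by exact_mod_cast Nat.le_succ n)
  have hfd' : (fderiv ℝ fun y => f (g y)) =
      fun y => ContinuousLinearMap.compL ℝ E E E (fderiv ℝ f (g y)) (fderiv ℝ g y) := by
    ext1 y
    exact fderiv_comp y (hfd _) (hgd _)
  rw [← norm_iteratedFDeriv_fderiv, hfd']
  refine ((ContinuousLinearMap.compL ℝ E E E).norm_iteratedFDeriv_le_of_bilinear_of_le_one
    (f := fun y => fderiv ℝ f (g y)) (g := fderiv ℝ g) (N := n)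
    (hf3.comp hgn) hg3 x le_rfl (ContinuousLinearMap.norm_compL_le ℝ E E E)).trans ?_
  rw [Finset.sum_range_succ', add_comm]
  refine add_le_add ?_ ?_
  · simp only [Nat.choose_zero_right, Nat.cast_one, one_mul, norm_iteratedFDeriv_zero, Nat.sub_zero,
      norm_iteratedFDeriv_fderiv]
    rw [norm_fderiv_of_one]
    gcongr
  · unfold compM
    refine Finset.sum_le_sum fun i hi => ?_
    have hi := Finset.mem_range.1 hi
    have h1 : ‖iteratedFDeriv ℝ (i + 1) (fun y => fderiv ℝ f (g y)) x‖
        ≤ (i + 1).factorial * C * D ^ (i + 1) := by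
      refine norm_iteratedFDeriv_comp_le (g := fderiv ℝ f) (f := g) (N := n) hf3 hgn
        (by exact_mod_cast hi) x ?_ ?_
      · intro j hj
        rw [norm_iteratedFDeriv_fderiv]
        exact hC _ (by omega) (by omega)
      · intro j hj1 hj
        exact (hD j hj1 (by omega)).trans (le_self_pow₀ hD1 (by omega))
    have h2 : ‖iteratedFDeriv ℝ (n - (i + 1)) (fderiv ℝ g) x‖ ≤ D := by
      rw [norm_iteratedFDeriv_fderiv]
      exact hD _ (by omega) (by omega)
    have h0 := (norm_nonneg _).trans (hC 1 le_rfl (by omega))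
    have : 0 ≤ D := by linarith
    gcongr

end Comp

section Sol
variable {E : Type} [NormedAddCommGroup E] [NormedSpace ℝ E]

lemma norm_smul_clm_le {X : Type} [NormedAddCommGroup X] [NormedSpace ℝ X] (A : X →L[ℝ] X) {t : ℝ}
    (ht : 0 ≤ t) : ‖t • A‖ ≤ t * ‖A‖ := by
  rw [norm_smul, Real.norm_of_nonneg ht]

/-- Constant curves. -/
noncomputable def constC : E →L[ℝ] C(unitInterval, E) :=
  LinearMap.mkContinuous
    { toFun := fun x => ContinuousMap.const _ x
      map_add' := by intros; ext; simp
      map_smul' := by intros; ext; simp } 1 (by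
    intro x
    rw [ContinuousMap.norm_le _ (by positivity)]
    intro s
    simp)

@[simp] lemma constC_apply (x : E) (s : unitInterval) : constC x s = x := rfl

lemma constC_norm_le : ‖(constC : E →L[ℝ] C(unitInterval, E))‖ ≤ 1 :=
  LinearMap.mkContinuous_norm_le _ zero_le_one _

lemma norm_iteratedFDeriv_clm_le {F G : Type} [NormedAddCommGroup F] [NormedSpace ℝ F]
    [NormedAddCommGroup G] [NormedSpace ℝ G] (A : F →L[ℝ] G) (hA : ‖A‖ ≤ 1) (k : ℕ) (hk : 1 ≤ k)
    (x : F) : ‖iteratedFDeriv ℝ k (fun y => A y) x‖ ≤ 1 := by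
  obtain ⟨n, rfl⟩ : ∃ n, k = n + 1 := ⟨k - 1, by omega⟩
  have : fderiv ℝ (fun y => A y) = fun _ => A := by ext1 y; exact A.fderiv
  rw [← norm_iteratedFDeriv_fderiv, this]
  rcases Nat.eq_zero_or_pos n with rfl | hn
  · simpa using hA
  · rw [iteratedFDeriv_const_of_ne hn.ne']
    simp

lemma norm_iteratedFDeriv_sub_clm {F G : Type} [NormedAddCommGroup F] [NormedSpace ℝ F]
    [NormedAddCommGroup G] [NormedSpace ℝ G] {k : ℕ} (u : F → G) (hu : ContDiff ℝ k u)
    (A : F →L[ℝ] G) (hA : ‖A‖ ≤ 1) (hk : 1 ≤ k) (x : F) :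
    ‖iteratedFDeriv ℝ k u x‖ ≤ ‖iteratedFDeriv ℝ k (fun y => u y - A y) x‖ + 1 := by
  have h1 : u = (fun y => u y - A y) + fun y => A y := by ext1 y; simp
  have h2 : ContDiff ℝ k (fun y => A y) := A.contDiff
  have h3 : ContDiff ℝ k (fun y => u y - A y) := hu.sub h2
  have h4 : iteratedFDeriv ℝ k u x = iteratedFDeriv ℝ k (fun y => u y - A y) x
      + iteratedFDeriv ℝ k (fun y => A y) x := by
    conv_lhs => rw [h1]
    exact iteratedFDeriv_add_apply h3.contDiffAt h2.contDiffAt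
  rw [h4]
  exact (norm_add_le _ _).trans (add_le_add le_rfl (norm_iteratedFDeriv_clm_le A hA _ hk x))

variable [CompleteSpace E]

lemma nem_lip {f : E → E} (hf : Differentiable ℝ f) {L : ℝ} 
    (hL : ∀ x, ‖iteratedFDeriv ℝ 1 f x‖ ≤ L) (u v : C(unitInterval, E)) :
    ‖nem f hf.continuous u - nem f hf.continuous v‖ ≤ L * ‖u - v‖ := by
  have hL0 : 0 ≤ L := (norm_nonneg _).trans (hL 0)
  rw [ContinuousMap.norm_le _ (by positivity)]
  intro s
  have := convex_univ.norm_image_sub_le_of_norm_fderiv_le (𝕜 := ℝ) (f := f) (C := L)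
    (x := v s) (y := u s) (fun x _ => hf x)
    (fun x _ => by rw [norm_fderiv_of_one]; exact hL x) (mem_univ _) (mem_univ _)
  exact this.trans (mul_le_mul_of_nonneg_left ((u - v).norm_coe_le_norm s) hL0)

/-- Smoothness of the solution operator for short time. -/
lemma sol_contDiff (k : ℕ) (hk : 1 ≤ k) {f : E → E} (hf : ContDiff ℝ k f) {L t : ℝ}
    (hL : ∀ x, ‖iteratedFDeriv ℝ 1 f x‖ ≤ L) (ht : 0 ≤ t) (htL : L * t ≤ 1 / 2)
    (u : E → C(unitInterval, E))
    (hu : ∀ x, u x = constC x + t • volt (nem f hf.continuous (u x))) :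
    ContDiff ℝ k u := by
  have hk0 : (k : WithTop ℕ∞) ≠ 0 := by exact_mod_cast (by omega : k ≠ 0)
  have hfd : Differentiable ℝ f := hf.differentiable hk0
  have hf' : Continuous (fderiv ℝ f) := hf.continuous_fderiv hk0
  have hL0 : 0 ≤ L := (norm_nonneg _).trans (hL 0)
  have hV : ∀ w : C(unitInterval, E), ‖volt w‖ ≤ ‖w‖ := fun w => by
    simpa using (volt (E := E)).le_of_opNorm_le volt_norm_le w
  -- continuity of `u`
  have hlip : ∀ x y, ‖u x - u y‖ ≤ 2 * ‖x - y‖ := by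
    intro x y
    have h1 : u x - u y = constC (x - y)
        + t • volt (nem f hf.continuous (u x) - nem f hf.continuous (u y)) := by
      rw [map_sub, map_sub, smul_sub]
      conv_lhs => rw [hu x, hu y]
      abel
    have h2 : ‖constC (x - y)‖ ≤ ‖x - y‖ := by
      simpa using (constC (E := E)).le_of_opNorm_le constC_norm_le (x - y)
    have h3 : ‖t • volt (nem f hf.continuous (u x) - nem f hf.continuous (u y))‖
        ≤ t * (L * ‖u x - u y‖) := by
      rw [norm_smul, Real.norm_of_nonneg ht]
      exact mul_le_mul_of_nonneg_left ((hV _).trans (nem_lip hfd hL _ _)) ht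
    have h4 : ‖u x - u y‖ ≤ ‖x - y‖ + t * (L * ‖u x - u y‖) := by
      conv_lhs => rw [h1]
      exact (norm_add_le _ _).trans (add_le_add h2 h3)
    nlinarith [norm_nonneg (u x - u y)]
  have hcont : Continuous u := by
    have : LipschitzWith 2 u := LipschitzWith.of_dist_le_mul fun x y => by
      simpa [dist_eq_norm] using hlip x y
    exact this.continuous
  -- the map to invert
  let H : C(unitInterval, E) → C(unitInterval, E) := fun w => w - t • volt (nem f hf.continuous w)
  have hH : ContDiff ℝ k H :=
    contDiff_id.sub (((volt (E := E)).contDiff.comp (nem_contDiff k f hf)).const_smul t)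
  have hHu : ∀ x, H (u x) = constC x := by
    intro x
    simp only [H]
    conv_lhs => lhs; rw [hu x]
    abel
  rw [contDiff_iff_contDiffAt]
  intro x₀
  let T : C(unitInterval, E) →L[ℝ] C(unitInterval, E) :=
    t • (volt.comp (nemMul (.id ℝ (E →L[ℝ] E)) (nem (fderiv ℝ f) hf' (u x₀))))
  have hT : ‖T‖ < 1 := by
    have h1 : ‖nemMul (.id ℝ (E →L[ℝ] E)) (nem (fderiv ℝ f) hf' (u x₀))‖ ≤ L := by
      refine (nemMul_norm_le _ ContinuousLinearMap.norm_id_le _).trans ?_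
      rw [ContinuousMap.norm_le _ hL0]
      intro s
      rw [nem_apply, norm_fderiv_of_one]
      exact hL _
    have h2 : ‖volt.comp (nemMul (.id ℝ (E →L[ℝ] E)) (nem (fderiv ℝ f) hf' (u x₀)))‖ ≤ 1 * L :=
      (ContinuousLinearMap.opNorm_comp_le _ _).trans
        (mul_le_mul volt_norm_le h1 (norm_nonneg _) zero_le_one)
    have h3 : ‖T‖ ≤ t * (1 * L) := by
      refine (norm_smul_clm_le _ ht).trans ?_
      exact mul_le_mul_of_nonneg_left h2 ht
    linarith
  let e : C(unitInterval, E) ≃L[ℝ] C(unitInterval, E) :=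
    ContinuousLinearEquiv.unitsEquiv ℝ _ (Units.oneSub T hT)
  have he : (e : C(unitInterval, E) →L[ℝ] C(unitInterval, E)) = .id ℝ _ - T := by
    ext1 w; rfl
  have hHd : HasFDerivAt H (e : C(unitInterval, E) →L[ℝ] C(unitInterval, E)) (u x₀) := by
    rw [he]
    exact (hasFDerivAt_id (u x₀)).sub
      (((volt (E := E)).hasFDerivAt.comp (u x₀) (nem_hasFDerivAt f hfd hf' (u x₀))).const_smul t)
  have hHa : ContDiffAt ℝ k H (u x₀) := hH.contDiffAt
  have h1 := hHa.to_localInverse hHd hk0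
  have h2 : ∀ᶠ w in 𝓝 (u x₀), hHa.localInverse hHd hk0 (H w) = w :=
    (hHa.hasStrictFDerivAt' hHd hk0).eventually_left_inverse
  have h3 : ∀ᶠ x in 𝓝 x₀, hHa.localInverse hHd hk0 (constC x) = u x := by
    filter_upwards [hcont.continuousAt.eventually h2] with x hx
    rwa [hHu] at hx
  rw [hHu] at h1
  refine ContDiffAt.congr_of_eventuallyEq (ContDiffAt.comp x₀ h1 (constC (E := E)).contDiff.contDiffAt) ?_
  filter_upwards [h3] with x hx
  exact hx.symm

/-- Derivative bounds for the solution operator for short time. -/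
lemma sol_bound (L : ℕ → ℝ) (hL1 : 0 < L 1) : ∀ k : ℕ, ∃ B : ℝ, 1 ≤ B ∧
    ∀ (f : E → E) (hf : ContDiff ℝ k f),
      (∀ j, 1 ≤ j → j ≤ k → ∀ x, ‖iteratedFDeriv ℝ j f x‖ ≤ L j) →
      ∀ t : ℝ, 0 ≤ t → L 1 * t ≤ 1 / 2 →
      ∀ u : E → C(unitInterval, E),
      (∀ x, u x = constC x + t • volt (nem f hf.continuous (u x))) → ContDiff ℝ k u →
      ∀ j, 1 ≤ j → j ≤ k → ∀ x, ‖iteratedFDeriv ℝ j u x‖ ≤ B ∧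
        ‖iteratedFDeriv ℝ j (fun y => u y - constC y) x‖ ≤ t * B := by
  intro k
  induction k with
  | zero => exact ⟨1, le_rfl, fun f hf _ t _ _ u _ _ j h1 h2 => by omega⟩
  | succ k ih =>
    obtain ⟨B, hB, ih⟩ := ih
    set C : ℝ := ∑ j ∈ Finset.range (k + 2), |L j| with hC
    have hLC : ∀ j, j ≤ k + 1 → L j ≤ C := fun j hj => (le_abs_self _).trans
      (Finset.single_le_sum (f := fun j => |L j|) (fun _ _ => abs_nonneg _)
        (Finset.mem_range.2 (by omega)))
    have hC0 : 0 ≤ C := Finset.sum_nonneg fun _ _ => abs_nonneg _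
    set M := compM k C B with hM
    have hM0 : 0 ≤ M := compM_nonneg k hC0 (by linarith)
    have hq : 0 ≤ (L 1 + M) / L 1 := by positivity
    refine ⟨B + 2 * (L 1 + M) + (L 1 + M) / L 1 + 1, by linarith, ?_⟩
    intro f hf hfL t ht htL u hu huC j hj1 hj x
    have hle : ((k : ℕ) : WithTop ℕ∞) ≤ ((k + 1 : ℕ) : WithTop ℕ∞) := by exact_mod_cast Nat.le_succ k
    have ih' := ih f (hf.of_le hle) (fun j h1 h2 => hfL j h1 (by omega)) t ht htL u hu
      (huC.of_le hle)
    rcases Nat.lt_or_ge k j with hjk | hjk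
    swap
    · obtain ⟨h1, h2⟩ := ih' j hj1 hjk x
      exact ⟨by linarith, h2.trans (mul_le_mul_of_nonneg_left (by linarith) ht)⟩
    obtain rfl : j = k + 1 := by omega
    have hnem : ContDiff ℝ (k + 1 : ℕ) fun y => nem f hf.continuous (u y) :=
      (nem_contDiff (k + 1) f hf).comp huC
    set a := ‖iteratedFDeriv ℝ (k + 1) (fun y => u y - constC y) x‖ with ha
    have ha0 : 0 ≤ a := norm_nonneg _
    -- bound on the derivative of `u`
    have hua : ‖iteratedFDeriv ℝ (k + 1) u x‖ ≤ a + 1 := by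
      exact norm_iteratedFDeriv_sub_clm u huC constC constC_norm_le (by omega) x
    -- evaluation
    have hev : ∀ s : unitInterval, ∀ i, i ≤ k + 1 → ∀ (w : E → C(unitInterval, E)),
        ContDiff ℝ (k + 1 : ℕ) w → ∀ m, iteratedFDeriv ℝ i (fun y => w y s) x m
          = (iteratedFDeriv ℝ i w x m) s := by
      intro s i hi w hw m
      have := (ContinuousMap.evalCLM ℝ (M := E) s).iteratedFDeriv_comp_left (f := w) (x := x)
        hw.contDiffAt (i := i) (by exact_mod_cast hi)
      have h2 := congrArg (fun A => A m) this
      exact h2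
    have hevn : ∀ s : unitInterval, ∀ i, i ≤ k + 1 →
        ‖iteratedFDeriv ℝ i (fun y => u y s) x‖ ≤ ‖iteratedFDeriv ℝ i u x‖ := by
      intro s i hi
      refine ContinuousMultilinearMap.opNorm_le_bound (norm_nonneg _) fun m => ?_
      rw [hev s i hi u huC]
      exact (ContinuousMap.norm_coe_le_norm _ s).trans (ContinuousMultilinearMap.le_opNorm _ _)
    have hus : ∀ s : unitInterval, ContDiff ℝ (k + 1 : ℕ) fun y => u y s := fun s =>
      (ContinuousMap.evalCLM ℝ (M := E) s).contDiff.comp huC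
    have hN : ‖iteratedFDeriv ℝ (k + 1) (fun y => nem f hf.continuous (u y)) x‖
        ≤ L 1 * (a + 1) + M := by
      refine ContinuousMultilinearMap.opNorm_le_bound (by positivity) fun m => ?_
      rw [ContinuousMap.norm_le _ (by positivity)]
      intro s
      rw [← hev s (k + 1) le_rfl _ hnem]
      refine (ContinuousMultilinearMap.le_opNorm _ _).trans
        (mul_le_mul_of_nonneg_right ?_ (by positivity))
      refine (comp_bound k (f := f) (g := fun y => u y s) hf (hus s) x (L := L 1) (C := C) (D := B)
        hB (hfL 1 le_rfl (by omega) _) (fun j h1 h2 => (hfL j h1 h2 _).trans (hLC j h2))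
        (fun j h1 h2 => (hevn s j (by omega)).trans (ih' j h1 h2 x).1)).trans ?_
      have := (hevn s (k + 1) le_rfl).trans hua
      gcongr
    have hY : (fun y => u y - constC y)
        = (t • volt (E := E)) ∘ fun y => nem f hf.continuous (u y) := by
      ext1 y
      conv_lhs => rw [hu y]
      simp
    have haN : a ≤ t * (L 1 * (a + 1) + M) := by
      rw [ha, hY]
      refine (ContinuousLinearMap.norm_iteratedFDeriv_comp_left _ hnem.contDiffAt le_rfl).trans ?_
      have : ‖t • volt (E := E)‖ ≤ t := by
        refine (norm_smul_clm_le _ ht).trans ?_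
        exact mul_le_of_le_one_right ht volt_norm_le
      rw [← hY]
      exact mul_le_mul this hN (norm_nonneg _) ht
    have ha1 : a ≤ t * (2 * (L 1 + M)) := by nlinarith
    have ha2 : a ≤ (L 1 + M) / L 1 := by
      rw [le_div_iff₀ hL1]
      nlinarith
    refine ⟨by linarith, ha1.trans (mul_le_mul_of_nonneg_left (by linarith) ht)⟩

end Sol

section Flow
variable {E : Type} [NormedAddCommGroup E] [NormedSpace ℝ E] [CompleteSpace E]

/-- Short-time bounds for the flow. -/
lemma flow_small (L : ℕ → ℝ) (hL1 : 0 < L 1) (k : ℕ) (hk : 1 ≤ k) : ∃ B : ℝ, 1 ≤ B ∧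
    ∀ (f : E → E), ContDiff ℝ k f →
      (∀ j, 1 ≤ j → j ≤ k → ∀ x, ‖iteratedFDeriv ℝ j f x‖ ≤ L j) →
      ∀ U : E → ℝ → E, (∀ x, U x 0 = x) → (∀ x t, HasDerivAt (U x) (f (U x t)) t) →
      ∀ t : ℝ, 0 ≤ t → L 1 * t ≤ 1 / 2 →
      ContDiff ℝ k (fun y => U y t) ∧
      ∀ j, 1 ≤ j → j ≤ k → ∀ x, ‖iteratedFDeriv ℝ j (fun y => U y t) x‖ ≤ B ∧
        ‖iteratedFDeriv ℝ j (fun y => U y t - y) x‖ ≤ t * B := by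
  obtain ⟨B, hB, h⟩ := sol_bound (E := E) L hL1 k
  refine ⟨B, hB, fun f hf hfL U hU0 hU t ht htL => ?_⟩
  have hUc : ∀ x, Continuous (U x) := fun x =>
    continuous_iff_continuousAt.2 fun t => (hU x t).continuousAt
  let u : E → C(unitInterval, E) := fun x =>
    ⟨fun s => U x (t * s), (hUc x).comp (continuous_const.mul continuous_subtype_val)⟩
  have hu : ∀ x, u x = constC x + t • volt (nem f hf.continuous (u x)) := by
    intro x
    ext s
    have h1 : ∫ r in (0:ℝ)..s, t • f (U x (t * r)) = U x (t * s) - U x (t * 0) := by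
      refine intervalIntegral.integral_eq_sub_of_hasDerivAt (f := fun r => U x (t * r)) ?_ ?_
      · intro r _
        have h2 : HasDerivAt (fun r : ℝ => t * r) t r := by
          simpa using (hasDerivAt_id r).const_mul t
        exact (hU x (t * r)).scomp r h2
      · apply Continuous.intervalIntegrable
        exact (hf.continuous.comp ((hUc x).comp (continuous_const.mul continuous_id))).const_smul t
    have h3 : volt (nem f hf.continuous (u x)) s = ∫ r in (0:ℝ)..s, f (U x (t * r)) := by
      rw [volt_apply]
      refine intervalIntegral.integral_congr fun r hr => ?_
      rw [uIcc_of_le s.2.1] at hr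
      have : r ∈ Icc (0:ℝ) 1 := ⟨hr.1, hr.2.trans s.2.2⟩
      simp only [nem_apply, u, ContinuousMap.coe_mk]
      rw [projIcc_of_mem _ this]
    rw [ContinuousMap.add_apply, ContinuousMap.smul_apply, h3, constC_apply,
      ← intervalIntegral.integral_smul, h1, mul_zero, hU0]
    simp [u]
  have huC : ContDiff ℝ k u :=
    sol_contDiff k hk hf (hfL 1 le_rfl hk) ht htL u hu
  have hone : ∀ y, U y t = u y 1 := fun y => by simp [u]
  have hb := h f hf hfL t ht htL u hu huC
  have hev : ∀ (w : E → C(unitInterval, E)), ContDiff ℝ k w → ∀ j, j ≤ k → ∀ x,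
      ‖iteratedFDeriv ℝ j (fun y => w y 1) x‖ ≤ ‖iteratedFDeriv ℝ j w x‖ := by
    intro w hw j hj x
    have h1 := (ContinuousMap.evalCLM ℝ (M := E) (1 : unitInterval)).iteratedFDeriv_comp_left
      (f := w) (x := x) hw.contDiffAt (i := j) (by exact_mod_cast hj)
    refine ContinuousMultilinearMap.opNorm_le_bound (norm_nonneg _) fun m => ?_
    have h2 : iteratedFDeriv ℝ j (fun y => w y 1) x m = (iteratedFDeriv ℝ j w x m) 1 :=
      congrArg (fun A => A m) h1
    rw [h2]
    exact (ContinuousMap.norm_coe_le_norm _ _).trans (ContinuousMultilinearMap.le_opNorm _ _)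
  refine ⟨?_, fun j hj1 hj x => ⟨?_, ?_⟩⟩
  · simp_rw [hone]
    exact (ContinuousMap.evalCLM ℝ (M := E) (1 : unitInterval)).contDiff.comp huC
  · simp_rw [hone]
    exact (hev u huC j hj x).trans (hb j hj1 hj x).1
  · simp_rw [hone]
    exact (hev (fun y => u y - constC y) (huC.sub (constC (E := E)).contDiff) j hj x).trans
      (hb j hj1 hj x).2

/-- Bounds for the flow after `m` short steps. -/
lemma flow_iter (L : ℕ → ℝ) (hL1 : 0 < L 1) (k : ℕ) (hk : 1 ≤ k) (m : ℕ) : ∃ B : ℝ, 1 ≤ B ∧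
    ∀ (f : E → E), ContDiff ℝ k f →
      (∀ j, 1 ≤ j → j ≤ k → ∀ x, ‖iteratedFDeriv ℝ j f x‖ ≤ L j) →
      ∀ U : E → ℝ → E, (∀ x, U x 0 = x) → (∀ x t, HasDerivAt (U x) (f (U x t)) t) →
      ∀ t : ℝ, 0 ≤ t → L 1 * t ≤ 1 / 2 →
      ContDiff ℝ k (fun y => U y (m * t)) ∧
      ∀ j, 1 ≤ j → j ≤ k → ∀ x, ‖iteratedFDeriv ℝ j (fun y => U y (m * t)) x‖ ≤ B := by
  induction m with
  | zero =>
    refine ⟨1, le_rfl, fun f hf hfL U hU0 hU t ht htL => ?_⟩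
    simp only [Nat.cast_zero, zero_mul, hU0]
    exact ⟨contDiff_id, fun j hj1 hj x =>
      norm_iteratedFDeriv_clm_le (.id ℝ E) ContinuousLinearMap.norm_id_le j hj1 x⟩
  | succ m ih =>
    obtain ⟨D, hD, ih⟩ := ih
    obtain ⟨C, hC, hs⟩ := flow_small (E := E) L hL1 k hk
    have hM0 : ∀ j, 0 ≤ compM j C D := fun j => compM_nonneg j (by linarith) (by linarith)
    have hS0 : 0 ≤ ∑ i ∈ Finset.range k, compM i C D := Finset.sum_nonneg fun i _ => hM0 i
    refine ⟨C * D + ∑ i ∈ Finset.range k, compM i C D, by nlinarith, ?_⟩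
    intro f hf hfL U hU0 hU t ht htL
    obtain ⟨i1, i2⟩ := ih f hf hfL U hU0 hU t ht htL
    obtain ⟨s1, s2⟩ := hs f hf hfL U hU0 hU t ht htL
    have hfd : Differentiable ℝ f := hf.differentiable (by exact_mod_cast (by omega : k ≠ 0))
    have hlip : LipschitzWith (L 1).toNNReal f := by
      refine lipschitzWith_of_nnnorm_fderiv_le hfd fun x => ?_
      rw [← NNReal.coe_le_coe, coe_nnnorm, Real.coe_toNNReal _ hL1.le, norm_fderiv_of_one]
      exact hfL 1 le_rfl hk x
    have hflow : ∀ y, U y ((m + 1 : ℕ) * t) = U (U y (m * t)) t := by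
      intro y
      have := ODE_solution_unique_univ (v := fun _ => f) (s := fun _ => univ) (t₀ := 0)
        (f := fun r => U y (r + m * t)) (g := U (U y (m * t)))
        (fun _ => hlip.lipschitzOnWith)
        (fun r => ⟨(hU y (r + m * t)).comp_add_const r (m * t), mem_univ _⟩)
        (fun r => ⟨hU _ r, mem_univ _⟩) (by simp [hU0])
      have h2 := congrFun this t
      rw [← h2]
      push_cast
      congr 1
      ring
    simp_rw [hflow]
    refine ⟨s1.comp i1, fun j hj1 hj x => ?_⟩
    obtain ⟨n, rfl⟩ : ∃ n, j = n + 1 := ⟨j - 1, by omega⟩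
    have hle : ((n + 1 : ℕ) : WithTop ℕ∞) ≤ k := by exact_mod_cast hj
    refine (comp_bound n (f := fun y => U y t) (g := fun y => U y (m * t)) (s1.of_le hle)
      (i1.of_le hle) x (L := C) (C := C) (D := D) hD (s2 1 le_rfl hk _).1
      (fun i h1 h2 => (s2 i h1 (by omega) _).1) (fun i h1 h2 => i2 i h1 (by omega) x)).trans ?_
    refine add_le_add (mul_le_mul_of_nonneg_left (i2 _ hj1 hj x) (by linarith)) ?_
    exact Finset.single_le_sum (f := fun i => compM i C D) (fun i _ => hM0 i)
      (Finset.mem_range.2 (by omega))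

end Flow


/-- Corollary `lmm:highDerivIncrem`.
Let `f : ℝ^d → ℝ^d` be `β`-times continuously differentiable with
`‖D^k f(x)‖_op ≤ L_k` for `k ∈ {1,…,β}` and all `x`.  Then for every `k ∈ {1,…,β}`
there is a constant `C_k > 0`, depending only on `k`, `Δt₀` and `L₁,…,L_k`
(in particular not on `f` or on the flow), such that for all `Δt ∈ [0, Δt₀]`,
`‖D_x^k Υ(f, Δt, x)‖_op ≤ C_k·(exp(L₁·Δt) − 1)` for all `x`, where
`Υ(f, Δt, x) = U(f, x, Δt) − x` is the increment map of the flow `U` of `u̇ = f(u)`. -/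
theorem stmt8 (d β : ℕ) (hβ : 1 ≤ β) (L : ℕ → ℝ)
    (hL : ∀ k, 1 ≤ k → k ≤ β → 0 < L k)
    (Δt₀ : ℝ) (hΔt₀ : 0 < Δt₀) :
    ∀ k, 1 ≤ k → k ≤ β →
      ∃ C > 0,
        ∀ (f : EuclideanSpace ℝ (Fin d) → EuclideanSpace ℝ (Fin d)),
          ContDiff ℝ (β : ℕ∞) f →
          (∀ j, 1 ≤ j → j ≤ β → ∀ x, ‖iteratedFDeriv ℝ j f x‖ ≤ L j) →
          ∀ (U : EuclideanSpace ℝ (Fin d) → ℝ → EuclideanSpace ℝ (Fin d)),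
            (∀ x, U x 0 = x) →
            (∀ x t, HasDerivAt (U x) (f (U x t)) t) →
            ∀ Δt, 0 ≤ Δt → Δt ≤ Δt₀ →
              ∀ x, ‖iteratedFDeriv ℝ k (fun y => U y Δt - y) x‖ ≤
                C * (Real.exp (L 1 * Δt) - 1) := by
  intro k hk hkβ
  have hL1 : 0 < L 1 := hL 1 le_rfl (by omega)
  obtain ⟨N, hN⟩ := exists_nat_gt (2 * (L 1 * Δt₀))
  have hN0 : (0 : ℝ) < N := lt_of_le_of_lt (by positivity) hN
  obtain ⟨B, hB, hs⟩ := flow_small (E := EuclideanSpace ℝ (Fin d)) L hL1 k hk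
  obtain ⟨D, hD, hi⟩ := flow_iter (E := EuclideanSpace ℝ (Fin d)) L hL1 k hk N
  refine ⟨B / L 1 + 2 * (D + 1), by positivity, ?_⟩
  intro f hf hfL U hU0 hU t ht htt x
  have hf' : ContDiff ℝ k f := hf.of_le (by exact_mod_cast hkβ)
  have hfL' : ∀ j, 1 ≤ j → j ≤ k → ∀ x, ‖iteratedFDeriv ℝ j f x‖ ≤ L j :=
    fun j h1 h2 => hfL j h1 (by omega)
  have hexp := Real.add_one_le_exp (L 1 * t)
  have hLt : 0 ≤ L 1 * t := by positivity
  have hBL : 0 ≤ B / L 1 := by positivity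
  by_cases hc : L 1 * t ≤ 1 / 2
  · have h1 := ((hs f hf' hfL' U hU0 hU t ht hc).2 k hk le_rfl x).2
    have h2 : t * B = B / L 1 * (L 1 * t) := by field_simp
    rw [h2] at h1
    refine h1.trans (mul_le_mul (by linarith) (by linarith) hLt (by linarith))
  · push Not at hc
    have hsm : L 1 * (t / N) ≤ 1 / 2 := by
      rw [← mul_div_assoc, div_le_iff₀ hN0]
      nlinarith
    obtain ⟨h1, h2⟩ := hi f hf' hfL' U hU0 hU (t / N) (by positivity) hsm
    have h3 : (N : ℝ) * (t / N) = t := by field_simp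
    rw [h3] at h1 h2
    have h4 := h2 k hk le_rfl x
    have h5 : iteratedFDeriv ℝ k (fun y => U y t - y) x
        = iteratedFDeriv ℝ k (fun y => U y t) x - iteratedFDeriv ℝ k (fun y => y) x :=
      iteratedFDeriv_sub_apply h1.contDiffAt contDiff_id.contDiffAt
    have h6 : ‖iteratedFDeriv ℝ k (fun y : EuclideanSpace ℝ (Fin d) => y) x‖ ≤ 1 :=
      norm_iteratedFDeriv_clm_le (.id ℝ _) ContinuousLinearMap.norm_id_le k hk x
    have h7 : ‖iteratedFDeriv ℝ k (fun y => U y t - y) x‖ ≤ D + 1 := by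
      rw [h5]
      exact (norm_sub_le _ _).trans (add_le_add h4 h6)
    have h8 : 1 / 2 ≤ Real.exp (L 1 * t) - 1 := by linarith
    nlinarith
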